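/- Let 𝒯 be a regular T-mesh occupying Ω = [x_l,x_r]×[y_b,y_t], let y₀ < y₁ < ⋯ < y_n be the distinct y-coordinates of the horizontal l-edges of 𝒯, and let g ∈ S̄(1,1,0,0,𝒯). Then the full family of conditions ∫_{x_l}^{x_r} ∂g/∂y(s,y_i−) ds = ∫_{x_l}^{x_r} ∂g/∂y(s,y_i+) ds for all i = 0,1,…,n is equivalent to the reduced family ∫_{x_l}^{x_r} ∂g/∂y(s,y_i−) ds = ∫_{x_l}^{x_r} ∂g/∂y(s,y_i+) ds for i = 1,…,n−1 only (i.e. the two conditions for the boundary indices i = 0 and i = n are redundant). The analogous statement holds for vertical l-edges. -/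

import Mathlib

open Filter Set MeasureTheory
open scoped Topology

noncomputable section

/-- A closed axis-aligned rectangle with positive side lengths. -/
structure Rect where
  xmin : ℝ
  xmax : ℝ
  ymin : ℝ
  ymax : ℝ
  hx : xmin < xmax
  hy : ymin < ymax

/-- The set of points of a rectangle. -/
def Rect.toSet (c : Rect) : Set (ℝ × ℝ) :=
  Set.Icc c.xmin c.xmax ×ˢ Set.Icc c.ymin c.ymax

/-- A regular T-mesh: finitely many cells (closed axis-aligned rectangles) with pairwise
disjoint interiors whose union is a closed axis-aligned rectangle. -/
structure TMesh where
  cells : Set Rect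
  outer : Rect
  finite_cells : cells.Finite
  pairwise_disjoint : cells.Pairwise fun c d => Disjoint (interior c.toSet) (interior d.toSet)
  union_eq : (⋃ c ∈ cells, c.toSet) = outer.toSet

/-- The region occupied by a T-mesh. -/
def TMesh.Omega (T : TMesh) : Set (ℝ × ℝ) := T.outer.toSet

/-- The edge skeleton of a T-mesh: the union of the boundaries of all cells. -/
def TMesh.skeleton (T : TMesh) : Set (ℝ × ℝ) := ⋃ c ∈ T.cells, frontier c.toSet

/-- A vertex of the mesh: a corner of some cell. -/
def IsVertexOf (T : TMesh) (p : ℝ × ℝ) : Prop :=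
  ∃ c ∈ T.cells, (p.1 = c.xmin ∨ p.1 = c.xmax) ∧ (p.2 = c.ymin ∨ p.2 = c.ymax)

/-- A crossing vertex: an interior vertex from which four small axis-parallel segments
stay inside the edge skeleton. -/
def IsCrossingVertex (T : TMesh) (p : ℝ × ℝ) : Prop :=
  IsVertexOf T p ∧ p ∈ interior T.Omega ∧
    ∃ ε > (0 : ℝ), segment ℝ p (p + (ε, 0)) ⊆ T.skeleton ∧
      segment ℝ p (p - (ε, 0)) ⊆ T.skeleton ∧
      segment ℝ p (p + (0, ε)) ⊆ T.skeleton ∧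
      segment ℝ p (p - (0, ε)) ⊆ T.skeleton

/-- A horizontal closed segment of positive length. -/
def IsHorizSeg (s : Set (ℝ × ℝ)) : Prop :=
  ∃ a b y : ℝ, a < b ∧ s = Set.Icc a b ×ˢ ({y} : Set ℝ)

/-- A vertical closed segment of positive length. -/
def IsVertSeg (s : Set (ℝ × ℝ)) : Prop :=
  ∃ x a b : ℝ, a < b ∧ s = ({x} : Set ℝ) ×ˢ Set.Icc a b

/-- An l-edge: a maximal axis-parallel closed segment of positive length contained in the
edge skeleton. -/
def IsLEdge (T : TMesh) (s : Set (ℝ × ℝ)) : Prop :=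
  (IsHorizSeg s ∨ IsVertSeg s) ∧ s ⊆ T.skeleton ∧
    ∀ s', (IsHorizSeg s' ∨ IsVertSeg s') → s' ⊆ T.skeleton → s ⊆ s' → s' = s

def IsBoundaryLEdge (T : TMesh) (s : Set (ℝ × ℝ)) : Prop :=
  IsLEdge T s ∧ s ⊆ frontier T.Omega

def IsInteriorLEdge (T : TMesh) (s : Set (ℝ × ℝ)) : Prop :=
  IsLEdge T s ∧ ¬ s ⊆ frontier T.Omega

/-- There is a horizontal l-edge with endpoints `(a,y)`, `(b,y)`. -/
def HorizLEdgeAt (T : TMesh) (a b y : ℝ) : Prop :=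
  a < b ∧ IsLEdge T (Set.Icc a b ×ˢ ({y} : Set ℝ))

/-- The number `V⁺` of crossing vertices. -/
def crossingCount (T : TMesh) : ℕ := {p | IsCrossingVertex T p}.ncard

/-- The number `E` of interior l-edges. -/
def interiorLEdgeCount (T : TMesh) : ℕ := {s | IsInteriorLEdge T s}.ncard

/-- The number `F` of cells. -/
def cellCount (T : TMesh) : ℕ := T.cells.ncard

/-! Partial derivatives (within a set) and smoothness. -/

def pdXW (S : Set (ℝ × ℝ)) (f : ℝ × ℝ → ℝ) : ℝ × ℝ → ℝ :=
  fun p => derivWithin (fun x => f (x, p.2)) {x | (x, p.2) ∈ S} p.1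

def pdYW (S : Set (ℝ × ℝ)) (f : ℝ × ℝ → ℝ) : ℝ × ℝ → ℝ :=
  fun p => derivWithin (fun y => f (p.1, y)) {y | (p.1, y) ∈ S} p.2

/-- The mixed partial derivative `∂^{i+j} f/∂x^i∂y^j`, taken within the set `S`. -/
def mpW (S : Set (ℝ × ℝ)) (i j : ℕ) (f : ℝ × ℝ → ℝ) : ℝ × ℝ → ℝ :=
  (pdYW S)^[j] ((pdXW S)^[i] f)

/-- `f` has continuous mixed partials `∂^{i+j}f/∂x^i∂y^j` on `S` for all `0 ≤ i ≤ α`,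
`0 ≤ j ≤ β` (smoothness indices `α, β ∈ ℤ` may be `-1`, in which case nothing is required
in that variable). -/
def SmoothWithin (S : Set (ℝ × ℝ)) (α β : ℤ) (f : ℝ × ℝ → ℝ) : Prop :=
  (∀ i j : ℕ, (i : ℤ) ≤ α → (j : ℤ) ≤ β → ContinuousOn (mpW S i j f) S) ∧
  (∀ i : ℕ, (i : ℤ) < α → ∀ p ∈ S,
    HasDerivWithinAt (fun x => (pdXW S)^[i] f (x, p.2)) ((pdXW S)^[i+1] f p)
      {x | (x, p.2) ∈ S} p.1) ∧
  (∀ i j : ℕ, (i : ℤ) ≤ α → (j : ℤ) < β → ∀ p ∈ S,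
    HasDerivWithinAt (fun y => mpW S i j f (p.1, y)) (mpW S i (j+1) f p)
      {y | (p.1, y) ∈ S} p.2)

/-- `f` agrees on each cell of `T` with a polynomial of bidegree at most `(m,n)`. -/
def PiecewisePoly (m n : ℕ) (T : TMesh) (f : ℝ × ℝ → ℝ) : Prop :=
  ∀ c ∈ T.cells, ∃ p : MvPolynomial (Fin 2) ℝ,
    p.degreeOf 0 ≤ m ∧ p.degreeOf 1 ≤ n ∧
    ∀ q ∈ c.toSet, f q = MvPolynomial.eval ![q.1, q.2] p

/-- The spline space with homogeneous boundary conditions `S̄(m,n,α,β,T)`. -/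
def SBar (m n : ℕ) (α β : ℤ) (T : TMesh) : Set (ℝ × ℝ → ℝ) :=
  {f | (∀ p, p ∉ T.Omega → f p = 0) ∧ PiecewisePoly m n T f ∧ SmoothWithin Set.univ α β f}

/-- The spline space `S(m,n,α,β,T)` over the T-mesh: membership only constrains the values
on the occupied region `Ω` (smoothness is required within `Ω`). -/
def SOn (m n : ℕ) (α β : ℤ) (T : TMesh) : Set (ℝ × ℝ → ℝ) :=
  {f | PiecewisePoly m n T f ∧ SmoothWithin T.Omega α β f}

/-- The set of functions `S` is a linear space of dimension `d`. -/
def HasDim (S : Set (ℝ × ℝ → ℝ)) (d : ℕ) : Prop :=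
  ∃ b : Fin d → (ℝ × ℝ → ℝ), (∀ i, b i ∈ S) ∧ LinearIndependent ℝ b ∧
    ∀ f ∈ S, ∃ c : Fin d → ℝ, f = ∑ i, c i • b i

/-- The linear space `S` has dimension at least `d`. -/
def DimGE (S : Set (ℝ × ℝ → ℝ)) (d : ℕ) : Prop :=
  ∃ b : Fin d → (ℝ × ℝ → ℝ), (∀ i, b i ∈ S) ∧ LinearIndependent ℝ b

/-- The set of functions `S`, regarded as a space of functions on `Ω` (i.e. modulo the
values outside `Ω`), has dimension `d`. -/
def HasDimOn (Ω : Set (ℝ × ℝ)) (S : Set (ℝ × ℝ → ℝ)) (d : ℕ) : Prop :=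
  ∃ b : Fin d → (ℝ × ℝ → ℝ), (∀ i, b i ∈ S) ∧
    LinearIndependent ℝ (fun i => Ω.restrict (b i)) ∧
    ∀ f ∈ S, ∃ c : Fin d → ℝ, Set.EqOn f (∑ i, c i • b i) Ω

/-! The integration operator `I` and one-sided limits. -/

/-- `I(g)(x,y) = ∫_{-∞}^x ∫_{-∞}^y g(s,t) dt ds`. -/
def Ig (g : ℝ × ℝ → ℝ) : ℝ × ℝ → ℝ :=
  fun p => ∫ s in Set.Iic p.1, (∫ t in Set.Iic p.2, g (s, t))

/-- `g(s, y−)`, the one-sided limit from below in the second variable. -/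
def limBelowY (g : ℝ × ℝ → ℝ) (y s : ℝ) : ℝ := limUnder (𝓝[<] y) fun t => g (s, t)
/-- `g(s, y+)`. -/
def limAboveY (g : ℝ × ℝ → ℝ) (y s : ℝ) : ℝ := limUnder (𝓝[>] y) fun t => g (s, t)
/-- `g(x−, t)`. -/
def limLeftX (g : ℝ × ℝ → ℝ) (x t : ℝ) : ℝ := limUnder (𝓝[<] x) fun s => g (s, t)
/-- `g(x+, t)`. -/
def limRightX (g : ℝ × ℝ → ℝ) (x t : ℝ) : ℝ := limUnder (𝓝[>] x) fun s => g (s, t)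

/-- The (cell-wise) partial derivative in `x`. -/
def pdX (f : ℝ × ℝ → ℝ) : ℝ × ℝ → ℝ := fun p => deriv (fun x => f (x, p.2)) p.1
/-- The (cell-wise) partial derivative in `y`. -/
def pdY (f : ℝ × ℝ → ℝ) : ℝ × ℝ → ℝ := fun p => deriv (fun y => f (p.1, y)) p.2

/-- The union of the open interiors of the cells. -/
def cellInteriors (T : TMesh) : Set (ℝ × ℝ) := ⋃ c ∈ T.cells, interior c.toSet

open Classical in
/-- The cell-wise mixed partial derivative `∂²f/∂x∂y`, set to `0` off the cell interiors. -/
def Dmix (T : TMesh) (f : ℝ × ℝ → ℝ) : ℝ × ℝ → ℝ :=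
  fun p => if p ∈ cellInteriors T then pdX (pdY f) p else 0

/-! Extended T-meshes. -/

/-- The skeleton of a tensor-product mesh with grid lines `X 0 < ⋯ < X (2m+1)` and
`Y 0 < ⋯ < Y (2n+1)`. -/
def gridSkeleton (m n : ℕ) (X Y : ℕ → ℝ) : Set (ℝ × ℝ) :=
  {p : ℝ × ℝ | (∃ i ≤ 2 * m + 1, p.1 = X i) ∧ Y 0 ≤ p.2 ∧ p.2 ≤ Y (2 * n + 1)} ∪
  {p : ℝ × ℝ | (∃ j ≤ 2 * n + 1, p.2 = Y j) ∧ X 0 ≤ p.1 ∧ p.1 ≤ X (2 * m + 1)}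

/-- The straight extensions, up to the rectangle `[x0,x1] × [y0,y1]`, of every l-edge of `T`
having an endpoint on the boundary of the region of `T`. -/
def extSegs (T : TMesh) (x0 x1 y0 y1 : ℝ) : Set (ℝ × ℝ) :=
  {p : ℝ × ℝ | ∃ a b y, HorizLEdgeAt T a b y ∧ a = T.outer.xmin ∧
      p.2 = y ∧ x0 ≤ p.1 ∧ p.1 ≤ a} ∪
  {p : ℝ × ℝ | ∃ a b y, HorizLEdgeAt T a b y ∧ b = T.outer.xmax ∧
      p.2 = y ∧ b ≤ p.1 ∧ p.1 ≤ x1} ∪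
  {p : ℝ × ℝ | ∃ x a b, a < b ∧ IsLEdge T (({x} : Set ℝ) ×ˢ Set.Icc a b) ∧ a = T.outer.ymin ∧
      p.1 = x ∧ y0 ≤ p.2 ∧ p.2 ≤ a} ∪
  {p : ℝ × ℝ | ∃ x a b, a < b ∧ IsLEdge T (({x} : Set ℝ) ×ˢ Set.Icc a b) ∧ b = T.outer.ymax ∧
      p.1 = x ∧ b ≤ p.2 ∧ p.2 ≤ y1}

/-- `Te` is an extension of `T` associated with `S(m,n,m-1,n-1,T)`: a tensor-product mesh with
`2(m+1)` vertical and `2(n+1)` horizontal grid lines whose central rectangle is the region of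
`T`, together with `T` and the straight extensions of all boundary-reaching edges of `T`. -/
def IsExtensionOf (m n : ℕ) (T Te : TMesh) : Prop :=
  ∃ X Y : ℕ → ℝ,
    (∀ i < 2 * m + 1, X i < X (i + 1)) ∧ (∀ j < 2 * n + 1, Y j < Y (j + 1)) ∧
    X m = T.outer.xmin ∧ X (m + 1) = T.outer.xmax ∧
    Y n = T.outer.ymin ∧ Y (n + 1) = T.outer.ymax ∧
    Te.outer.xmin = X 0 ∧ Te.outer.xmax = X (2 * m + 1) ∧
    Te.outer.ymin = Y 0 ∧ Te.outer.ymax = Y (2 * n + 1) ∧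
    Te.skeleton = T.skeleton ∪ gridSkeleton m n X Y ∪
      extSegs T (X 0) (X (2 * m + 1)) (Y 0) (Y (2 * n + 1))

/-! Hierarchical T-meshes. -/

/-- `T` is a tensor-product mesh. -/
def IsTensorMesh (T : TMesh) : Prop :=
  ∃ (p q : ℕ) (x y : ℕ → ℝ), 0 < p ∧ 0 < q ∧
    (∀ i < p, x i < x (i + 1)) ∧ (∀ j < q, y j < y (j + 1)) ∧
    T.cells = {c : Rect | ∃ i < p, ∃ j < q,
      c.xmin = x i ∧ c.xmax = x (i + 1) ∧ c.ymin = y j ∧ c.ymax = y (j + 1)}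

/-- The four equal subcells obtained by subdividing a cell by the two segments joining the
midpoints of opposite edges. -/
def Rect.quads (c : Rect) : Set Rect :=
  { ⟨c.xmin, (c.xmin + c.xmax) / 2, c.ymin, (c.ymin + c.ymax) / 2,
      by linarith [c.hx], by linarith [c.hy]⟩,
    ⟨(c.xmin + c.xmax) / 2, c.xmax, c.ymin, (c.ymin + c.ymax) / 2,
      by linarith [c.hx], by linarith [c.hy]⟩,
    ⟨c.xmin, (c.xmin + c.xmax) / 2, (c.ymin + c.ymax) / 2, c.ymax,
      by linarith [c.hx], by linarith [c.hy]⟩,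
    ⟨(c.xmin + c.xmax) / 2, c.xmax, (c.ymin + c.ymax) / 2, c.ymax,
      by linarith [c.hx], by linarith [c.hy]⟩ }

/-- `T'` is obtained from `T` by subdividing exactly the cells in `S` into four quadrants. -/
def StepSubdiv (T T' : TMesh) (S : Set Rect) : Prop :=
  S ⊆ T.cells ∧ T'.outer = T.outer ∧
    T'.cells = (T.cells \ S) ∪ ⋃ c ∈ S, Rect.quads c

/-- A hierarchical T-mesh: the recursive construction `𝒯⁰, 𝒯¹, …, 𝒯^M`. -/
structure HierMesh where
  M : ℕ
  level : ℕ → TMesh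
  subdivided : ℕ → Set Rect
  tensor0 : IsTensorMesh (level 0)
  step : ∀ k < M, StepSubdiv (level k) (level (k + 1)) (subdivided k)

/-- The final mesh `𝒯 = 𝒯^M`. -/
def HierMesh.final (H : HierMesh) : TMesh := H.level H.M

/-- Two cells share a (horizontal or vertical) edge segment of positive length. -/
def EdgeAdjacent (c d : Rect) : Prop :=
  c ≠ d ∧ ∃ s : Set (ℝ × ℝ), (IsHorizSeg s ∨ IsVertSeg s) ∧ s ⊆ c.toSet ∩ d.toSet

/-- `c` is an isolated subdivided cell at step `k`: it is subdivided at step `k`, but no cell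
of the level-`k` mesh sharing a horizontal or vertical edge with it is subdivided then. -/
def IsIsolatedAt (H : HierMesh) (k : ℕ) (c : Rect) : Prop :=
  k < H.M ∧ c ∈ H.subdivided k ∧
    ∀ d ∈ (H.level k).cells, EdgeAdjacent c d → d ∉ H.subdivided k

/-- The isolated subdivided cells occurring in the construction of `H`. -/
def isoCells (H : HierMesh) : Set Rect := {c | ∃ k, IsIsolatedAt H k c}

/-- A regular T-mesh is crossing-vertex connected: any two distinct crossing vertices are
joined by a poly-line of axis-parallel mesh edges all of whose (corner) joints are crossing
vertices. -/
def IsCVConnected (T : TMesh) : Prop :=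
  ∀ u v : ℝ × ℝ, IsCrossingVertex T u → IsCrossingVertex T v → u ≠ v →
    ∃ (N : ℕ) (p : ℕ → ℝ × ℝ), p 0 = u ∧ p N = v ∧
      (∀ i < N, p i ≠ p (i + 1) ∧ segment ℝ (p i) (p (i + 1)) ⊆ T.skeleton ∧
        ((p i).1 = (p (i + 1)).1 ∨ (p i).2 = (p (i + 1)).2)) ∧
      (∀ i, 0 < i → i < N →
        (((p (i - 1)).2 = (p i).2 ∧ (p i).1 = (p (i + 1)).1) ∨
         ((p (i - 1)).1 = (p i).1 ∧ (p i).2 = (p (i + 1)).2)) →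
        IsCrossingVertex T (p i))

/-- The level of an l-edge `s`: the first level of the hierarchy whose skeleton contains it. -/
def LEdgeLevel (H : HierMesh) (s : Set (ℝ × ℝ)) (k : ℕ) : Prop :=
  s ⊆ (H.level k).skeleton ∧ ∀ j < k, ¬ s ⊆ (H.level j).skeleton

/-- `yb < yi < yt` are the heights of the two support l-edges of the horizontal l-edge
`[a,b] × {yi}` of the hierarchical mesh `H`: for a level-0 l-edge, the nearest level-0
horizontal l-edges below and above; for a level-`(k+1)` l-edge, the heights of the bottom
and top edges of a cell subdivided at step `k` whose inserted cross has its horizontal arm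
on the l-edge. -/
def SupportHeights (H : HierMesh) (a b yi yb yt : ℝ) : Prop :=
  yb < yi ∧ yi < yt ∧
  ((LEdgeLevel H (Set.Icc a b ×ˢ ({yi} : Set ℝ)) 0 ∧
     (∃ a' b', HorizLEdgeAt (H.level 0) a' b' yb) ∧
     (∃ a' b', HorizLEdgeAt (H.level 0) a' b' yt) ∧
     (∀ y a' b', HorizLEdgeAt (H.level 0) a' b' y → ¬(yb < y ∧ y < yt ∧ y ≠ yi))) ∨
   (∃ k, LEdgeLevel H (Set.Icc a b ×ˢ ({yi} : Set ℝ)) (k + 1) ∧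
     ∃ c ∈ H.subdivided k, c.ymin = yb ∧ c.ymax = yt ∧ (c.ymin + c.ymax) / 2 = yi ∧
       a ≤ c.xmin ∧ c.xmax ≤ b))

/-- `U j` is a proper submesh of `U i` (its region is strictly contained in that of `U i`). -/
def ProperSubmesh {ι : Type*} (U : ι → TMesh) (j i : ι) : Prop :=
  j ≠ i ∧ (U j).Omega ⊆ (U i).Omega ∧ (U j).Omega ≠ (U i).Omega

/-! The CVR graph. -/

/-- An edge of the CVR graph: a segment joining two consecutive crossing vertices along an
l-edge. -/
def IsCVREdge (T : TMesh) (s : Set (ℝ × ℝ)) : Prop :=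
  ∃ u v : ℝ × ℝ, u ≠ v ∧ s = segment ℝ u v ∧ IsCrossingVertex T u ∧ IsCrossingVertex T v ∧
    (∃ l, IsLEdge T l ∧ segment ℝ u v ⊆ l) ∧
    ∀ w ∈ segment ℝ u v, IsCrossingVertex T w → w = u ∨ w = v

/-- The union of the edges of the CVR graph, as a plane set. -/
def cvrGraphSet (T : TMesh) : Set (ℝ × ℝ) := ⋃₀ {s | IsCVREdge T s}

/-- The number of edges of the CVR graph. -/
def cvrEdgeCount (T : TMesh) : ℕ := {s | IsCVREdge T s}.ncard

/-- The number of bounded faces of the CVR graph: bounded connected components of the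
complement of the union of its edges. -/
def cvrFaceCount (T : TMesh) : ℕ :=
  {U : Set (ℝ × ℝ) | (∃ p ∈ (cvrGraphSet T)ᶜ, U = connectedComponentIn (cvrGraphSet T)ᶜ p) ∧
     Bornology.IsBounded U}.ncard
theorem MvPolynomial.eval_eq_affine_of_degreeOf_one_le {p : MvPolynomial (Fin 2) ℝ}
    (hp : p.degreeOf 1 ≤ 1) (s : ℝ) :
    ∃ A B : ℝ, ∀ t : ℝ, MvPolynomial.eval ![s, t] p = A + B * t := by
  refine ⟨MvPolynomial.eval ![s, 0] p,
    MvPolynomial.eval ![s, 1] p - MvPolynomial.eval ![s, 0] p, fun t => ?_⟩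
  simp only [MvPolynomial.eval_eq', ← Finset.sum_sub_distrib, Finset.sum_mul,
    ← Finset.sum_add_distrib]
  refine Finset.sum_congr rfl fun d hd => ?_
  have hd1 : d 1 ≤ 1 := MvPolynomial.degreeOf_le_iff.mp hp d hd
  simp only [Fin.prod_univ_two, Matrix.cons_val_zero, Matrix.cons_val_one]
  interval_cases d 1 <;> simp [mul_assoc]

theorem Rect.isClosed_toSet (c : Rect) : IsClosed c.toSet :=
  isClosed_Icc.prod isClosed_Icc

theorem Rect.mem_frontier_of_horizontal {c : Rect} {x y : ℝ} (hx : x ∈ Icc c.xmin c.xmax)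
    (hy : y = c.ymin ∨ y = c.ymax) : (x, y) ∈ frontier c.toSet := by
  rw [Rect.toSet, frontier_prod_eq, closure_Icc, frontier_Icc c.hy.le]
  exact Or.inl ⟨hx, hy⟩

theorem TMesh.skeleton_subset (T : TMesh) : T.skeleton ⊆ T.outer.toSet := by
  rw [← T.union_eq]
  exact iUnion₂_mono fun c _ => c.isClosed_toSet.frontier_subset

theorem TMesh.isClosed_skeleton (T : TMesh) : IsClosed T.skeleton :=
  T.finite_cells.isClosed_biUnion fun _ _ => isClosed_frontier

theorem TMesh.exists_cell (T : TMesh) {p : ℝ × ℝ} (hp : p ∈ T.outer.toSet) :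
    ∃ c ∈ T.cells, p ∈ c.toSet := by
  simpa [← T.union_eq] using hp

theorem TMesh.cell_subset (T : TMesh) {c : Rect} (hc : c ∈ T.cells) :
    c.toSet ⊆ T.outer.toSet := by
  rw [← T.union_eq]
  exact subset_biUnion_of_mem (u := Rect.toSet) hc

theorem exists_horizLEdgeAt_of_subset_skeleton (T : TMesh) {u v y : ℝ} (huv : u < v)
    (h : ∀ x ∈ Icc u v, (x, y) ∈ T.skeleton) : ∃ a b, HorizLEdgeAt T a b y := by
  set K : Set ℝ := (fun x => (x, y)) ⁻¹' T.skeleton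
  have hKc : IsCompact K := by
    refine isCompact_Icc.of_isClosed_subset
      (T.isClosed_skeleton.preimage (by fun_prop)) (fun x hx => ?_)
      (s := Icc T.outer.xmin T.outer.xmax)
    exact (T.skeleton_subset hx).1
  have huK : u ∈ K := h u (left_mem_Icc.mpr huv.le)
  set C := connectedComponentIn K u
  have hCK : C ⊆ K := connectedComponentIn_subset K u
  have hsub : Icc u v ⊆ C :=
    isPreconnected_Icc.subset_connectedComponentIn (left_mem_Icc.mpr huv.le) h
  have hCclosed : IsClosed C := closure_subset_iff_isClosed.mp <|
    isPreconnected_connectedComponentIn.closure.subset_connectedComponentIn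
      (subset_closure (mem_connectedComponentIn huK)) (closure_minimal hCK hKc.isClosed)
  have hCeq : C = Icc (sInf C) (sSup C) :=
    eq_Icc_of_connected_compact (isConnected_connectedComponentIn_iff.mpr huK)
      (hKc.of_isClosed_subset hCclosed hCK)
  have huC : u ∈ C := hsub (left_mem_Icc.mpr huv.le)
  have hvC : v ∈ C := hsub (right_mem_Icc.mpr huv.le)
  have hlt : sInf C < sSup C := by
    have h1 := hCeq ▸ huC
    have h2 := hCeq ▸ hvC
    exact h1.1.trans_lt (huv.trans_le h2.2)
  refine ⟨sInf C, sSup C, hlt, Or.inl ⟨_, _, y, hlt, rfl⟩, ?_, ?_⟩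
  · rw [← hCeq]
    rintro ⟨x, z⟩ ⟨hx, rfl⟩
    exact hCK hx
  · rw [← hCeq]
    intro s' hs' hsk hss'
    have hu' : (u, y) ∈ s' := hss' ⟨huC, rfl⟩
    have hv' : (v, y) ∈ s' := hss' ⟨hvC, rfl⟩
    refine Subset.antisymm ?_ hss'
    rcases hs' with ⟨a, b, z, -, rfl⟩ | ⟨x, a, b, -, rfl⟩
    · obtain rfl : y = z := hu'.2
      rintro ⟨x, w⟩ ⟨hx, rfl⟩
      have hK' : Icc a b ⊆ K := fun x' hx' => hsk (mk_mem_prod hx' rfl)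
      exact ⟨isPreconnected_Icc.subset_connectedComponentIn hu'.1 hK' hx, rfl⟩
    · have h1 : u = x := hu'.1
      have h2 : v = x := hv'.1
      exact absurd (h1.trans h2.symm) huv.ne

theorem exists_horizLEdgeAt_of_cell (T : TMesh) {c : Rect} (hc : c ∈ T.cells) {y : ℝ}
    (hy : y = c.ymin ∨ y = c.ymax) : ∃ a b, HorizLEdgeAt T a b y :=
  exists_horizLEdgeAt_of_subset_skeleton T c.hx fun _ hx =>
    mem_biUnion hc (Rect.mem_frontier_of_horizontal hx hy)

theorem HorizLEdgeAt.mem_Icc {T : TMesh} {a b y : ℝ} (h : HorizLEdgeAt T a b y) :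
    y ∈ Icc T.outer.ymin T.outer.ymax :=
  (T.skeleton_subset (h.2.2.1 (mk_mem_prod (left_mem_Icc.mpr h.1.le) rfl))).2

theorem exists_horizLEdgeAt_ymin (T : TMesh) : ∃ a b, HorizLEdgeAt T a b T.outer.ymin := by
  obtain ⟨c, hc, hcm⟩ := T.exists_cell (p := (T.outer.xmin, T.outer.ymin))
    ⟨left_mem_Icc.mpr T.outer.hx.le, left_mem_Icc.mpr T.outer.hy.le⟩
  have hc' : (c.xmin, c.ymin) ∈ T.outer.toSet :=
    T.cell_subset hc ⟨left_mem_Icc.mpr c.hx.le, left_mem_Icc.mpr c.hy.le⟩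
  exact exists_horizLEdgeAt_of_cell T hc (Or.inl (le_antisymm hc'.2.1 hcm.2.1))

theorem exists_horizLEdgeAt_ymax (T : TMesh) : ∃ a b, HorizLEdgeAt T a b T.outer.ymax := by
  obtain ⟨c, hc, hcm⟩ := T.exists_cell (p := (T.outer.xmin, T.outer.ymax))
    ⟨left_mem_Icc.mpr T.outer.hx.le, right_mem_Icc.mpr T.outer.hy.le⟩
  have hc' : (c.xmax, c.ymax) ∈ T.outer.toSet :=
    T.cell_subset hc ⟨right_mem_Icc.mpr c.hx.le, right_mem_Icc.mpr c.hy.le⟩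
  exact exists_horizLEdgeAt_of_cell T hc (Or.inr (le_antisymm hcm.2.2 hc'.2.2))

theorem pdY_eq_of_affineOn {g : ℝ × ℝ → ℝ} {s a b A B t : ℝ}
    (h : ∀ t ∈ Ioo a b, g (s, t) = A + B * t) (ht : t ∈ Ioo a b) : pdY g (s, t) = B := by
  have hd : HasDerivAt (fun t => A + B * t) B t := by
    simpa using ((hasDerivAt_id t).const_mul B).const_add A
  exact (hd.congr_of_eventuallyEq
    (Filter.mem_of_superset (Ioo_mem_nhds ht.1 ht.2) h)).deriv

theorem limAboveY_pdY_of_affineOn {g : ℝ × ℝ → ℝ} {s a b A B : ℝ} (hab : a < b)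
    (h : ∀ t ∈ Ioo a b, g (s, t) = A + B * t) : limAboveY (pdY g) a s = B :=
  (tendsto_const_nhds.congr' (Filter.mem_of_superset (Ioo_mem_nhdsGT hab)
    fun _ ht => (pdY_eq_of_affineOn h ht).symm)).limUnder_eq

theorem limBelowY_pdY_of_affineOn {g : ℝ × ℝ → ℝ} {s a b A B : ℝ} (hab : a < b)
    (h : ∀ t ∈ Ioo a b, g (s, t) = A + B * t) : limBelowY (pdY g) b s = B :=
  (tendsto_const_nhds.congr' (Filter.mem_of_superset (Ioo_mem_nhdsLT hab)
    fun _ ht => (pdY_eq_of_affineOn h ht).symm)).limUnder_eq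

section SBar

variable {T : TMesh} {g : ℝ × ℝ → ℝ}

theorem continuous_of_mem_SBar {m n : ℕ} {α β : ℤ} (hα : 0 ≤ α) (hβ : 0 ≤ β)
    (hg : g ∈ SBar m n α β T) : Continuous g :=
  continuousOn_univ.mp (hg.2.2.1 0 0 hα hβ)

theorem eq_zero_of_ymin (hg : ∀ p, p ∉ T.Omega → g p = 0) (hc : Continuous g) (s : ℝ) :
    g (s, T.outer.ymin) = 0 := by
  have h1 : Tendsto (fun t => g (s, t)) (𝓝[<] T.outer.ymin) (𝓝 (g (s, T.outer.ymin))) :=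
    ((show Continuous fun t => g (s, t) by fun_prop).tendsto _).mono_left nhdsWithin_le_nhds
  refine tendsto_nhds_unique h1 (tendsto_const_nhds.congr' ?_)
  filter_upwards [self_mem_nhdsWithin] with t ht
  exact (hg _ fun h => (h.2.1.trans_lt ht).false).symm

theorem eq_zero_of_ymax (hg : ∀ p, p ∉ T.Omega → g p = 0) (hc : Continuous g) (s : ℝ) :
    g (s, T.outer.ymax) = 0 := by
  have h1 : Tendsto (fun t => g (s, t)) (𝓝[>] T.outer.ymax) (𝓝 (g (s, T.outer.ymax))) :=
    ((show Continuous fun t => g (s, t) by fun_prop).tendsto _).mono_left nhdsWithin_le_nhds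
  refine tendsto_nhds_unique h1 (tendsto_const_nhds.congr' ?_)
  filter_upwards [self_mem_nhdsWithin] with t ht
  exact (hg _ fun h => (h.2.2.trans_lt ht).false).symm

theorem limBelowY_pdY_ymin (hg : ∀ p, p ∉ T.Omega → g p = 0) (s : ℝ) :
    limBelowY (pdY g) T.outer.ymin s = 0 :=
  limBelowY_pdY_of_affineOn (A := 0) (sub_one_lt T.outer.ymin) fun t ht => by
    rw [hg _ fun h => (h.2.1.trans_lt ht.2).false]
    ring

theorem limAboveY_pdY_ymax (hg : ∀ p, p ∉ T.Omega → g p = 0) (s : ℝ) :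
    limAboveY (pdY g) T.outer.ymax s = 0 :=
  limAboveY_pdY_of_affineOn (A := 0) (lt_add_one T.outer.ymax) fun t ht => by
    rw [hg _ fun h => (ht.1.trans_le h.2.2).false]
    ring

/-- On a horizontal strip containing no horizontal cell edge, the restriction of a piecewise
bilinear function to a vertical line is affine. -/
theorem PiecewisePoly.exists_affineOn_strip {m : ℕ} (hg : PiecewisePoly m 1 T g) {s a b : ℝ}
    (hs : s ∈ Icc T.outer.xmin T.outer.xmax) (hab : a < b) (ha : T.outer.ymin ≤ a)
    (hb : b ≤ T.outer.ymax)
    (hstrip : ∀ c ∈ T.cells, ∀ y, y = c.ymin ∨ y = c.ymax → y ≤ a ∨ b ≤ y) :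
    ∃ A B, ∀ t ∈ Icc a b, g (s, t) = A + B * t := by
  obtain ⟨c, hc, hsc, hmin, hmax⟩ := T.exists_cell (p := (s, (a + b) / 2))
    ⟨hs, by dsimp; linarith, by dsimp; linarith⟩
  dsimp only at hmin hmax
  have h1 : c.ymin ≤ a := (hstrip c hc _ (Or.inl rfl)).resolve_right fun h => by linarith
  have h2 : b ≤ c.ymax := (hstrip c hc _ (Or.inr rfl)).resolve_left fun h => by linarith
  obtain ⟨p, -, hp, hpe⟩ := hg c hc
  obtain ⟨A, B, hAB⟩ := MvPolynomial.eval_eq_affine_of_degreeOf_one_le hp s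
  exact ⟨A, B, fun t ht => (hpe (s, t) ⟨hsc, h1.trans ht.1, ht.2.trans h2⟩).trans (hAB t)⟩

theorem lim_pdY_eq_slope_of_strip {m : ℕ} (hg : PiecewisePoly m 1 T g) {s a b : ℝ}
    (hs : s ∈ Icc T.outer.xmin T.outer.xmax) (hab : a < b) (ha : T.outer.ymin ≤ a)
    (hb : b ≤ T.outer.ymax)
    (hstrip : ∀ c ∈ T.cells, ∀ y, y = c.ymin ∨ y = c.ymax → y ≤ a ∨ b ≤ y) :
    limAboveY (pdY g) a s = (g (s, b) - g (s, a)) / (b - a) ∧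
      limBelowY (pdY g) b s = (g (s, b) - g (s, a)) / (b - a) := by
  obtain ⟨A, B, h⟩ := hg.exists_affineOn_strip hs hab ha hb hstrip
  have hslope : (g (s, b) - g (s, a)) / (b - a) = B := by
    rw [h a (left_mem_Icc.mpr hab.le), h b (right_mem_Icc.mpr hab.le),
      div_eq_iff (sub_pos.mpr hab).ne']
    ring
  have h' : ∀ t ∈ Ioo a b, g (s, t) = A + B * t := fun t ht => h t (Ioo_subset_Icc_self ht)
  exact ⟨(limAboveY_pdY_of_affineOn hab h').trans hslope.symm,
    (limBelowY_pdY_of_affineOn hab h').trans hslope.symm⟩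

theorem integral_lim_pdY_of_strip {m : ℕ} (hg : PiecewisePoly m 1 T g) (hc : Continuous g)
    {a b : ℝ} (hab : a < b) (ha : T.outer.ymin ≤ a) (hb : b ≤ T.outer.ymax)
    (hstrip : ∀ c ∈ T.cells, ∀ y, y = c.ymin ∨ y = c.ymax → y ≤ a ∨ b ≤ y) :
    (∫ s in T.outer.xmin..T.outer.xmax, limAboveY (pdY g) a s) * (b - a) =
        (∫ s in T.outer.xmin..T.outer.xmax, g (s, b)) -
          ∫ s in T.outer.xmin..T.outer.xmax, g (s, a) ∧
      (∫ s in T.outer.xmin..T.outer.xmax, limBelowY (pdY g) b s) =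
        ∫ s in T.outer.xmin..T.outer.xmax, limAboveY (pdY g) a s := by
  have hlim := fun s hs => lim_pdY_eq_slope_of_strip hg (s := s) hs hab ha hb hstrip
  have hIcc : uIcc T.outer.xmin T.outer.xmax = Icc T.outer.xmin T.outer.xmax :=
    uIcc_of_le T.outer.hx.le
  constructor
  · rw [intervalIntegral.integral_congr fun s hs => (hlim s (hIcc ▸ hs)).1,
      intervalIntegral.integral_div, div_mul_cancel₀ _ (sub_pos.mpr hab).ne']
    exact intervalIntegral.integral_sub
      (Continuous.intervalIntegrable (by fun_prop) _ _)
      (Continuous.intervalIntegrable (by fun_prop) _ _)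
  · exact intervalIntegral.integral_congr fun s hs =>
      (hlim s (hIcc ▸ hs)).2.trans (hlim s (hIcc ▸ hs)).1.symm

end SBar

/-- **Lemma 4.3.** With notation as in Lemma 4.2, the full family of derivative-jump
conditions (for `i = 0, 1, …, n`) is equivalent to the reduced family for `i = 1, …, n−1`
only: the two boundary conditions are redundant. (The analogous statement for vertical
l-edges follows by instantiating this universally quantified theorem at the transposed
mesh.) -/
theorem deriv_jump_boundary_redundant (T : TMesh) (g : ℝ × ℝ → ℝ)
    (hg : g ∈ SBar 1 1 0 0 T)
    (n : ℕ) (ys : ℕ → ℝ) (hmono : ∀ i < n, ys i < ys (i + 1))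
    (hys : ∀ y : ℝ, (∃ a b : ℝ, HorizLEdgeAt T a b y) ↔ ∃ i ≤ n, ys i = y) :
    (∀ i ≤ n, (∫ s in T.outer.xmin..T.outer.xmax, limBelowY (pdY g) (ys i) s) =
        ∫ s in T.outer.xmin..T.outer.xmax, limAboveY (pdY g) (ys i) s) ↔
    (∀ i, 0 < i → i < n →
      (∫ s in T.outer.xmin..T.outer.xmax, limBelowY (pdY g) (ys i) s) =
        ∫ s in T.outer.xmin..T.outer.xmax, limAboveY (pdY g) (ys i) s) := by
  refine ⟨fun h i _ hi => h i hi.le, fun h => ?_⟩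
  have hc : Continuous g := continuous_of_mem_SBar le_rfl le_rfl hg
  obtain ⟨hzero, hpoly, -⟩ := hg
  have hstrict : StrictMonoOn ys (Iic n) :=
    strictMonoOn_Iic_of_lt_succ fun i hi => hmono i hi
  have hmem : ∀ i ≤ n, ys i ∈ Icc T.outer.ymin T.outer.ymax := fun i hi => by
    obtain ⟨a, b, hab⟩ := (hys (ys i)).mpr ⟨i, hi, rfl⟩
    exact hab.mem_Icc
  have hy0 : ys 0 = T.outer.ymin := by
    obtain ⟨i, hi, hie⟩ := (hys _).mp (exists_horizLEdgeAt_ymin T)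
    exact le_antisymm (hie ▸ hstrict.monotoneOn (mem_Iic.mpr n.zero_le) hi i.zero_le)
      (hmem 0 n.zero_le).1
  have hyn : ys n = T.outer.ymax := by
    obtain ⟨i, hi, hie⟩ := (hys _).mp (exists_horizLEdgeAt_ymax T)
    exact le_antisymm (hmem n le_rfl).2
      (hie ▸ hstrict.monotoneOn hi (mem_Iic.mpr le_rfl) hi)
  have hn : 0 < n := by
    refine Nat.pos_of_ne_zero fun h0 => T.outer.hy.ne ?_
    rw [← hy0, ← hyn, h0]
  have hstep : ∀ i < n, _ := fun i hi =>
    integral_lim_pdY_of_strip hpoly hc (hmono i hi) (hmem i hi.le).1 (hmem (i + 1) hi).2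
      fun c hcT y hy => by
        obtain ⟨j, hj, rfl⟩ := (hys y).mp (exists_horizLEdgeAt_of_cell T hcT hy)
        rcases Nat.lt_or_ge i j with hij | hij
        · exact Or.inr (hstrict.monotoneOn (mem_Iic.mpr hi) hj hij)
        · exact Or.inl (hstrict.monotoneOn hj (mem_Iic.mpr hi.le) hij)
  set D : ℕ → ℝ := fun i => ∫ s in T.outer.xmin..T.outer.xmax, limAboveY (pdY g) (ys i) s
  set G : ℕ → ℝ := fun i => ∫ s in T.outer.xmin..T.outer.xmax, g (s, ys i) with hG
  have hDconst : ∀ i < n, D i = D 0 := by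
    intro i
    induction i with
    | zero => exact fun _ => rfl
    | succ i ih =>
      intro hi
      rw [← ih (i.lt_succ_self.trans hi)]
      exact (h (i + 1) i.succ_pos hi).symm.trans (hstep i (i.lt_succ_self.trans hi)).2
  have hGlin : ∀ i ≤ n, D 0 * (ys i - ys 0) = G i - G 0 := by
    intro i
    induction i with
    | zero => simp
    | succ i ih =>
      intro hi
      have h1 : D i * (ys (i + 1) - ys i) = G (i + 1) - G i := (hstep i hi).1
      rw [hDconst i hi] at h1
      linarith [ih (i.le_succ.trans hi)]
  have hG0 : G 0 = 0 := by simp [hG, hy0, eq_zero_of_ymin hzero hc]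
  have hGn : G n = 0 := by simp [hG, hyn, eq_zero_of_ymax hzero hc]
  have hD0 : D 0 = 0 := by
    have h1 := hGlin n le_rfl
    rw [hG0, hGn, sub_zero, hy0, hyn] at h1
    exact (mul_eq_zero.mp h1).resolve_right (sub_pos.mpr T.outer.hy).ne'
  intro i hi
  rcases Nat.eq_zero_or_pos i with rfl | hi0
  · refine Eq.trans ?_ hD0.symm
    simp [hy0, limBelowY_pdY_ymin hzero]
  rcases hi.lt_or_eq with hlt | rfl
  · exact h i hi0 hlt
  · obtain ⟨k, rfl⟩ := Nat.exists_eq_succ_of_ne_zero hi0.ne'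
    refine ((hstep k k.lt_succ_self).2.trans ((hDconst k k.lt_succ_self).trans hD0)).trans ?_
    simp [hyn, limAboveY_pdY_ymax hzero]
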